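/- arXiv:2005.07907 — 3 statements merged into one kernel-verified Lean document; each statement's English description precedes it below -/
import Mathlib

section
/- Let k, t, p, q be integers with k ≥ 2t, t ≥ 1, 1 ≤ p ≤ 2t − 1 and 1 ≤ q ≤ k − 2t + 1. Then C_{p,q} is a submatrix of A_{k,t}. -/
/-- The `n × n` circulant 0,1-matrix (as a `Bool`-matrix) whose entry in row `i`,
column `j` is `1` iff `(i - j) mod n < p`.  `Cmat (p+q) p` is the matrix `C_{p,q}`. -/
def Cmat (n p : ℕ) : Matrix (Fin n) (Fin n) Bool :=
  fun i j => decide ((i.val + n - j.val) % n < p)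

/-- A 0,1-matrix `C` of size `n × m` is a submatrix of `A_{k,t}`: there are pairwise
distinct `t`-element subsets `A i` of `[k]` indexing the rows and pairwise distinct
`t`-element subsets `B j` of `[k]` indexing the columns such that `C i j = 1` iff
`A i ∩ B j ≠ ∅`. -/
def IsSubmatrixOfA (k t : ℕ) {n m : ℕ} (C : Matrix (Fin n) (Fin m) Bool) : Prop :=
  ∃ (A : Fin n → Finset (Fin k)) (B : Fin m → Finset (Fin k)),
    Function.Injective A ∧ Function.Injective B ∧
    (∀ i, (A i).card = t) ∧ (∀ j, (B j).card = t) ∧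
    (∀ i j, C i j = true ↔ (A i ∩ B j).Nonempty)

/-- Boolean product of 0,1-matrices: `(X·Y)[i][j] = 1` iff there is `l` with
`X[i][l] = 1` and `Y[l][j] = 1`. -/
def boolMul {n r m : ℕ} (X : Matrix (Fin n) (Fin r) Bool)
    (Y : Matrix (Fin r) (Fin m) Bool) : Matrix (Fin n) (Fin m) Bool :=
  fun i j => decide (∃ l, X i l = true ∧ Y l j = true)

/-- The number of ones in a 0,1-vector. -/
def wt {n : ℕ} (v : Fin n → Bool) : ℕ := (Finset.univ.filter fun a => v a = true).card

/-- A square 0,1-matrix is an isolation matrix: there is a permutation `σ` with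
`B[i][σ i] = 1` for all `i`, and no two of these ones lie in a `2 × 2` all-one
submatrix. -/
def IsIsolation {s : ℕ} (B : Matrix (Fin s) (Fin s) Bool) : Prop :=
  ∃ σ : Equiv.Perm (Fin s), (∀ i, B i (σ i) = true) ∧
    ∀ i j, i ≠ j → ¬(B i (σ j) = true ∧ B j (σ i) = true)

theorem add_sub_mod_eq_ite {n i u : ℕ} (hi : i < n) (hu : u < n) :
    (i + n - u) % n = if u ≤ i then i - u else i + n - u := by
  split_ifs with h
  · rw [show i + n - u = i - u + n by omega, Nat.add_mod_right, Nat.mod_eq_of_lt (by omega)]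
  · exact Nat.mod_eq_of_lt (by omega)

theorem add_mod_eq_ite_of_lt {n j v : ℕ} (hj : j < n) (hv : v < n) :
    (j + v) % n = if j + v < n then j + v else j + v - n := by
  split_ifs with h
  · exact Nat.mod_eq_of_lt h
  · rw [Nat.mod_eq_sub_mod (by omega), Nat.mod_eq_of_lt (by omega)]

/-- The cyclic arc `{i, i - 1, …, i - (a - 1)}` modulo `n`, padded with `[c, c + s)`. -/
def downArc (n a c s i : ℕ) : Finset ℕ :=
  (Finset.range a).image (fun u => (i + n - u) % n) ∪ Finset.Ico c (c + s)

/-- The cyclic arc `{j, j + 1, …, j + (b - 1)}` modulo `n`, padded with `[c, c + s)`. -/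
def upArc (n b c s j : ℕ) : Finset ℕ :=
  (Finset.range b).image (fun v => (j + v) % n) ∪ Finset.Ico c (c + s)

theorem mem_downArc {n a c s i x : ℕ} :
    x ∈ downArc n a c s i ↔ (∃ u < a, (i + n - u) % n = x) ∨ (c ≤ x ∧ x < c + s) := by
  simp [downArc]

theorem mem_upArc {n b c s j x : ℕ} :
    x ∈ upArc n b c s j ↔ (∃ v < b, (j + v) % n = x) ∨ (c ≤ x ∧ x < c + s) := by
  simp [upArc]

theorem card_image_union_Ico {n a c s : ℕ} {f : ℕ → ℕ} (hc : n ≤ c)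
    (hf : ∀ u < a, f u < n) (hinj : Set.InjOn f (Finset.range a)) :
    ((Finset.range a).image f ∪ Finset.Ico c (c + s)).card = a + s := by
  rw [Finset.card_union_of_disjoint, Finset.card_image_of_injOn hinj]
  · simp
  · rw [Finset.disjoint_left]
    intro x hx hx'
    obtain ⟨u, hu, rfl⟩ := Finset.mem_image.mp hx
    have := hf u (Finset.mem_range.mp hu)
    have := (Finset.mem_Ico.mp hx').1
    omega

theorem card_downArc {n a c s i : ℕ} (hi : i < n) (ha : a ≤ n) (hc : n ≤ c) :
    (downArc n a c s i).card = a + s := by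
  refine card_image_union_Ico hc (fun u _ => Nat.mod_lt _ (by omega)) ?_
  intro u hu v hv h
  simp only [Finset.coe_range, Set.mem_Iio] at hu hv
  simp only [add_sub_mod_eq_ite hi (hu.trans_le ha), add_sub_mod_eq_ite hi (hv.trans_le ha)] at h
  split_ifs at h <;> omega

theorem card_upArc {n b c s j : ℕ} (hj : j < n) (hb : b ≤ n) (hc : n ≤ c) :
    (upArc n b c s j).card = b + s := by
  refine card_image_union_Ico hc (fun u _ => Nat.mod_lt _ (by omega)) ?_
  intro u hu v hv h
  simp only [Finset.coe_range, Set.mem_Iio] at hu hv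
  simp only [add_mod_eq_ite_of_lt hj (hu.trans_le hb), add_mod_eq_ite_of_lt hj (hv.trans_le hb)] at h
  split_ifs at h <;> omega

theorem exists_mem_downArc_upArc_iff {n a b c r s i j : ℕ} (hi : i < n) (hj : j < n)
    (ha : 1 ≤ a) (hb : 1 ≤ b) (hab : a + b ≤ n) (hc : n ≤ c) :
    (∃ x, x ∈ downArc n a c r i ∧ x ∈ upArc n b (c + r) s j) ↔
      (i + n - j) % n < a + b - 1 := by
  simp only [mem_downArc, mem_upArc, add_sub_mod_eq_ite hi hj]
  constructor
  · rintro ⟨x, ⟨u, hu, hux⟩ | hx, ⟨v, hv, hvx⟩ | hx'⟩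
    · rw [add_sub_mod_eq_ite hi (by omega)] at hux
      rw [add_mod_eq_ite_of_lt hj (by omega)] at hvx
      split_ifs at * <;> omega
    · have : x < n := hux ▸ Nat.mod_lt _ (by omega)
      omega
    · have : x < n := hvx ▸ Nat.mod_lt _ (by omega)
      omega
    · omega
  · intro h
    obtain ⟨d, hd⟩ : ∃ d, d = if j ≤ i then i - j else i + n - j := ⟨_, rfl⟩
    rw [← hd] at h
    refine ⟨_, .inl ⟨min d (a - 1), by omega, rfl⟩, .inl ⟨d - min d (a - 1), by omega, ?_⟩⟩
    rw [add_sub_mod_eq_ite hi (by omega), add_mod_eq_ite_of_lt hj (by omega)]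
    split_ifs at * <;> omega

theorem Cmat_eq_true_iff {n p : ℕ} {i j : Fin n} :
    Cmat n p i j = true ↔ (i.val + n - j.val) % n < p := by
  simp [Cmat]

theorem Cmat_injective {n p : ℕ} (hp : 1 ≤ p) (hpn : p < n) :
    Function.Injective (Cmat n p) := by
  intro i i' h
  have hi := i.isLt
  have hi' := i'.isLt
  have hrow (j : Fin n) : (i.val + n - j.val) % n < p ↔ (i'.val + n - j.val) % n < p := by
    rw [← Cmat_eq_true_iff, ← Cmat_eq_true_iff, h]
  have hs : (i.val + 1) % n < n := Nat.mod_lt _ (by omega)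
  have h₁ := hrow i
  have h₂ := hrow ⟨(i.val + 1) % n, hs⟩
  simp only [add_sub_mod_eq_ite hi hi, add_sub_mod_eq_ite hi' hi, add_sub_mod_eq_ite hi hs,
    add_sub_mod_eq_ite hi' hs] at h₁ h₂
  rw [add_mod_eq_ite_of_lt hi (by omega)] at h₂
  ext
  split_ifs at * <;> omega

theorem Cmat_transpose_injective {n p : ℕ} (hp : 1 ≤ p) (hpn : p < n) :
    Function.Injective (Cmat n p).transpose := by
  intro j j' h
  have hj := j.isLt
  have hj' := j'.isLt
  have hcol (i : Fin n) : (i.val + n - j.val) % n < p ↔ (i.val + n - j'.val) % n < p := by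
    rw [← Cmat_eq_true_iff, ← Cmat_eq_true_iff]
    exact iff_of_eq (congrArg (· = true) (congrFun h i))
  have hs : (j.val + n - 1) % n < n := Nat.mod_lt _ (by omega)
  have h₁ := hcol j
  have h₂ := hcol ⟨(j.val + n - 1) % n, hs⟩
  simp only [add_sub_mod_eq_ite hj hj, add_sub_mod_eq_ite hj hj', add_sub_mod_eq_ite hs hj,
    add_sub_mod_eq_ite hs hj'] at h₁ h₂
  rw [add_sub_mod_eq_ite hj (by omega)] at h₂
  ext
  split_ifs at * <;> omega

/-- for `k ≥ 2t`, `t ≥ 1`, `1 ≤ p ≤ 2t - 1` and `1 ≤ q ≤ k - 2t + 1`,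
`C_{p,q}` is a submatrix of `A_{k,t}`. -/
theorem stmt_1 (k t p q : ℕ) (ht : 1 ≤ t) (hk : 2 * t ≤ k)
    (hp1 : 1 ≤ p) (hp2 : p ≤ 2 * t - 1) (hq1 : 1 ≤ q) (hq2 : q ≤ k - 2 * t + 1) :
    IsSubmatrixOfA k t (Cmat (p + q) p) := by
  obtain ⟨a, b, ha, hat, hb, hbt, hab⟩ :
      ∃ a b, 1 ≤ a ∧ a ≤ t ∧ 1 ≤ b ∧ b ≤ t ∧ a + b = p + 1 :=
    ⟨min p t, p + 1 - min p t, by omega, by omega, by omega, by omega, by omega⟩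
  obtain ⟨n, hn⟩ : ∃ n, n = p + q := ⟨_, rfl⟩
  rw [← hn]
  have hA (i : Fin n) : ∀ x ∈ downArc n a n (t - a) i, x < k := by
    intro x hx
    rcases mem_downArc.mp hx with ⟨u, _, rfl⟩ | hx
    · exact (Nat.mod_lt _ (by omega)).trans_le (by omega)
    · omega
  have hB (j : Fin n) : ∀ x ∈ upArc n b (n + (t - a)) (t - b) j, x < k := by
    intro x hx
    rcases mem_upArc.mp hx with ⟨u, _, rfl⟩ | hx
    · exact (Nat.mod_lt _ (by omega)).trans_le (by omega)
    · omega
  have hAB (i j : Fin n) : Cmat n p i j = true ↔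
      (Finset.attachFin _ (hA i) ∩ Finset.attachFin _ (hB j)).Nonempty := by
    rw [Cmat_eq_true_iff, show p = a + b - 1 by omega,
      ← exists_mem_downArc_upArc_iff (c := n) (r := t - a) (s := t - b) i.isLt j.isLt ha hb
        (by omega) le_rfl]
    simp only [Finset.Nonempty, Finset.mem_inter, Finset.mem_attachFin]
    exact ⟨fun ⟨x, hx⟩ => ⟨⟨x, hA i x hx.1⟩, hx⟩, fun ⟨x, hx⟩ => ⟨x, hx⟩⟩
  refine ⟨fun i => Finset.attachFin _ (hA i), fun j => Finset.attachFin _ (hB j),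
    fun i i' h => ?_, fun j j' h => ?_, fun i => ?_, fun j => ?_, hAB⟩
  · refine Cmat_injective hp1 (by omega : p < n) (funext fun j => ?_)
    rw [Bool.eq_iff_iff, hAB, hAB,
      show Finset.attachFin _ (hA i) = Finset.attachFin _ (hA i') from h]
  · refine Cmat_transpose_injective hp1 (by omega : p < n) (funext fun i => ?_)
    rw [Matrix.transpose_apply, Matrix.transpose_apply, Bool.eq_iff_iff, hAB, hAB,
      show Finset.attachFin _ (hB j) = Finset.attachFin _ (hB j') from h]
  · rw [Finset.card_attachFin, card_downArc i.isLt (by omega) le_rfl]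
    omega
  · rw [Finset.card_attachFin, card_upArc j.isLt (by omega) (by omega)]
    omega
end

section
/- Let p, q be positive integers with q ≥ p − 1, n = p + q, and let X·Y = C_{p,q} be a Boolean decomposition where X is an n×r 0,1-matrix with columns x_1,...,x_r and Y is an r×n 0,1-matrix with rows y_1,...,y_r. Then there exist n distinct indices i_1,...,i_n ∈ {1,...,r} such that |x_{i_j}| > 0 and |y_{i_j}| > 0 for every j ∈ {1,...,n}; in particular r ≥ n. -/
theorem Cmat_self {n p : ℕ} (hp : 0 < p) (j : Fin n) : Cmat n p j j = true := by
  simpa [Cmat] using hp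

/-- The diagonal ones of `Cmat n p` are pairwise isolated when `2 * p ≤ n + 1`. -/
theorem Cmat_isolated {n p : ℕ} (h : 2 * p ≤ n + 1) {i j : Fin n}
    (hij : Cmat n p i j = true) (hji : Cmat n p j i = true) : i = j := by
  wlog hle : j ≤ i generalizing i j
  · exact (this hji hij (le_of_not_ge hle)).symm
  by_contra hne
  have hlt : j < i := lt_of_le_of_ne hle (Ne.symm hne)
  rw [Fin.lt_def] at hlt
  simp only [Cmat, decide_eq_true_eq] at hij hji
  rw [show i.val + n - j.val = i.val - j.val + n by omega, Nat.add_mod_right,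
    Nat.mod_eq_of_lt (by omega)] at hij
  rw [Nat.mod_eq_of_lt (by omega)] at hji
  omega

theorem boolMul_eq_true_iff {n r m : ℕ} {X : Matrix (Fin n) (Fin r) Bool}
    {Y : Matrix (Fin r) (Fin m) Bool} {i : Fin n} {j : Fin m} :
    boolMul X Y i j = true ↔ ∃ l, X i l = true ∧ Y l j = true := by
  simp [boolMul]

theorem wt_pos_of_eq_true {n : ℕ} {v : Fin n → Bool} {a : Fin n} (h : v a = true) :
    0 < wt v :=
  Finset.card_pos.mpr ⟨a, by simpa using h⟩

/-- in any Boolean decomposition `X·Y = C_{p,q}` with `p, q > 0` and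
`q ≥ p - 1`, there are `n = p + q` distinct indices `i` for which both the column
`x_i` of `X` and the row `y_i` of `Y` are nonzero; in particular `r ≥ n`. -/
theorem stmt_7 (p q r : ℕ) (hp : 0 < p) (hq : 0 < q) (hqp : p - 1 ≤ q)
    (X : Matrix (Fin (p + q)) (Fin r) Bool) (Y : Matrix (Fin r) (Fin (p + q)) Bool)
    (hXY : boolMul X Y = Cmat (p + q) p) :
    (∃ f : Fin (p + q) → Fin r, Function.Injective f ∧
      ∀ j, 0 < wt (fun a => X a (f j)) ∧ 0 < wt (fun b => Y (f j) b)) ∧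
    p + q ≤ r := by
  have hdiag (j : Fin (p + q)) : ∃ l, X j l = true ∧ Y l j = true :=
    boolMul_eq_true_iff.mp (hXY ▸ Cmat_self hp j)
  choose f hX hY using hdiag
  have hf : Function.Injective f := by
    intro i j hij
    apply Cmat_isolated (n := p + q) (p := p) (by omega)
    · exact hXY ▸ boolMul_eq_true_iff.mpr ⟨f i, hX i, hij ▸ hY j⟩
    · exact hXY ▸ boolMul_eq_true_iff.mpr ⟨f j, hX j, hij ▸ hY i⟩
  exact ⟨⟨f, hf, fun j => ⟨wt_pos_of_eq_true (hX j), wt_pos_of_eq_true (hY j)⟩⟩,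
    by simpa using Fintype.card_le_of_injective f hf⟩
end

section
/- Let p, q be positive integers with q ≥ p − 1, and let n = p + q. Let X·Y = C_{p,q} be a Boolean decomposition where X is an n×r 0,1-matrix and Y is an r×n 0,1-matrix. Then r ≥ n and the total number of 1-entries in X plus the total number of 1-entries in Y is at most (p+1)·n + (r−n)·n. -/
theorem mod_sub_eq_ite {n a b : ℕ} (ha : a < n) (hb : b < n) :
    (a + n - b) % n = if b ≤ a then a - b else a + n - b := by
  split_ifs with hba
  · rw [show a + n - b = a - b + n by omega, Nat.add_mod_right, Nat.mod_eq_of_lt (by omega)]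
  · exact Nat.mod_eq_of_lt (by omega)

/-- A rectangle of ones of `C_{p,q}` meeting the diagonal has semiperimeter at most `p + 1`. -/
theorem card_add_card_le_of_mem_diagonal {n p : ℕ} (hn : 2 * p - 1 ≤ n)
    {A B : Finset (Fin n)} (hAB : ∀ a ∈ A, ∀ b ∈ B, Cmat n p a b = true)
    {c : Fin n} (hcA : c ∈ A) (hcB : c ∈ B) : A.card + B.card ≤ p + 1 := by
  simp only [Cmat, decide_eq_true_eq] at hAB
  let f : Fin n → ℕ := fun a => (a.val + n - c.val) % n
  let g : Fin n → ℕ := fun b => (c.val + n - b.val) % n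
  obtain ⟨a, ha, hmaxa⟩ := A.exists_max_image f ⟨c, hcA⟩
  obtain ⟨b, hb, hmaxb⟩ := B.exists_max_image g ⟨c, hcB⟩
  have hA : A.card ≤ f a + 1 := by
    rw [← Finset.card_range (f a + 1)]
    refine Finset.card_le_card_of_injOn f (fun x hx => ?_) (fun x _ y _ hxy => ?_)
    · simpa [Nat.lt_succ_iff] using hmaxa x hx
    · simp only [f, mod_sub_eq_ite x.2 c.2, mod_sub_eq_ite y.2 c.2] at hxy
      split_ifs at hxy <;> omega
  have hB : B.card ≤ g b + 1 := by
    rw [← Finset.card_range (g b + 1)]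
    refine Finset.card_le_card_of_injOn g (fun x hx => ?_) (fun x _ y _ hxy => ?_)
    · simpa [Nat.lt_succ_iff] using hmaxb x hx
    · simp only [g, mod_sub_eq_ite c.2 x.2, mod_sub_eq_ite c.2 y.2] at hxy
      split_ifs at hxy <;> omega
  have h1 := hAB a ha c hcB
  have h2 := hAB c hcA b hb
  have h3 := hAB a ha b hb
  simp only [f, g] at hA hB
  rw [mod_sub_eq_ite a.2 c.2] at h1 hA
  rw [mod_sub_eq_ite c.2 b.2] at h2 hB
  rw [mod_sub_eq_ite a.2 b.2] at h3
  split_ifs at h1 h2 h3 hA hB <;> omega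

/-- The diagonal ones of `C_{p,q}` are pairwise isolated when `q ≥ p - 1`. -/
theorem eq_of_Cmat_of_Cmat_swap {n p : ℕ} (hn : 2 * p - 1 ≤ n) {a b : Fin n}
    (hab : Cmat n p a b = true) (hba : Cmat n p b a = true) : a = b := by
  simp only [Cmat, decide_eq_true_eq] at hab hba
  rw [mod_sub_eq_ite a.2 b.2] at hab
  rw [mod_sub_eq_ite b.2 a.2] at hba
  split_ifs at hab hba <;> omega

/-- in any Boolean decomposition `X·Y = C_{p,q}` with `p, q > 0` and
`q ≥ p - 1`, we have `r ≥ n` and the total number of ones in `X` and `Y` together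
is at most `(p+1)·n + (r-n)·n`, where `n = p + q`. -/
theorem stmt_8 (p q r : ℕ) (hp : 0 < p) (hq : 0 < q) (hqp : p - 1 ≤ q)
    (X : Matrix (Fin (p + q)) (Fin r) Bool) (Y : Matrix (Fin r) (Fin (p + q)) Bool)
    (hXY : boolMul X Y = Cmat (p + q) p) :
    p + q ≤ r ∧
    (Finset.univ.filter fun ij : Fin (p + q) × Fin r => X ij.1 ij.2 = true).card +
      (Finset.univ.filter fun ij : Fin r × Fin (p + q) => Y ij.1 ij.2 = true).card ≤
      (p + 1) * (p + q) + (r - (p + q)) * (p + q) := by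
  have hn : 2 * p - 1 ≤ p + q := by omega
  have hone : ∀ i j l, X i l = true → Y l j = true → Cmat (p + q) p i j = true := by
    intro i j l hX hY
    rw [← hXY]
    simpa [boolMul] using ⟨l, hX, hY⟩
  have hdiag : ∀ c : Fin (p + q), ∃ l, X c l = true ∧ Y l c = true := by
    intro c
    have h : boolMul X Y c c = true := by
      rw [hXY]
      simpa [Cmat] using hp
    simpa [boolMul] using h
  choose f hfX hfY using hdiag
  have hf : Function.Injective f := fun a b hab =>
    eq_of_Cmat_of_Cmat_swap hn (hone a b (f a) (hfX a) (hab ▸ hfY b))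
      (hone b a (f a) (hab ▸ hfX b) (hfY a))
  have hr : p + q ≤ r := by simpa using Fintype.card_le_of_injective f hf
  refine ⟨hr, ?_⟩
  let A : Fin r → Finset (Fin (p + q)) := fun l => Finset.univ.filter fun i => X i l = true
  let B : Fin r → Finset (Fin (p + q)) := fun l => Finset.univ.filter fun j => Y l j = true
  have hmeet : ∀ l c, c ∈ A l → c ∈ B l → (A l).card + (B l).card ≤ p + 1 := fun l c hA hB =>
    card_add_card_le_of_mem_diagonal hn
      (fun a ha b hb => hone a b l (by simpa [A] using ha) (by simpa [B] using hb)) hA hB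
  have hall : ∀ l, (A l).card + (B l).card ≤ p + q := by
    intro l
    by_cases h : Disjoint (A l) (B l)
    · rw [← Finset.card_union_of_disjoint h]
      simpa using Finset.card_le_univ (A l ∪ B l)
    · obtain ⟨c, hA, hB⟩ := Finset.not_disjoint_iff.mp h
      exact (hmeet l c hA hB).trans (by omega)
  have hXsum : (Finset.univ.filter fun ij : Fin (p + q) × Fin r => X ij.1 ij.2 = true).card =
      ∑ l, (A l).card := by
    simp only [A, Finset.card_filter]
    rw [Fintype.sum_prod_type_right]
  have hYsum : (Finset.univ.filter fun ij : Fin r × Fin (p + q) => Y ij.1 ij.2 = true).card =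
      ∑ l, (B l).card := by
    simp only [B, Finset.card_filter]
    rw [Fintype.sum_prod_type]
  have hS : (Finset.univ.image f).card = p + q := by
    simp [Finset.card_image_of_injective _ hf]
  rw [hXsum, hYsum, ← Finset.sum_add_distrib, ← Finset.sum_add_sum_compl (Finset.univ.image f)]
  refine add_le_add ?_ ?_
  · refine (Finset.sum_le_card_nsmul _ _ (p + 1) fun l hl => ?_).trans_eq ?_
    · obtain ⟨c, -, rfl⟩ := Finset.mem_image.mp hl
      exact hmeet _ c (by simpa [A] using hfX c) (by simpa [B] using hfY c)
    · rw [hS, smul_eq_mul, mul_comm]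
  · refine (Finset.sum_le_card_nsmul _ _ (p + q) fun l _ => hall l).trans_eq ?_
    rw [Finset.card_compl, hS, Fintype.card_fin, smul_eq_mul]
end
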